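/- arXiv:1711.07881 — 7 statements merged into one kernel-verified Lean document; each statement's English description precedes it below -/
import Mathlib

section
/- For every ρ ∈ Φ_O and every x ∈ Φ, the Weyl reflection w_ρ(x) = x − 2((x,ρ)/(ρ,ρ))ρ = x − (x,ρ)ρ again lies in Φ; that is, the set of extended roots Φ of e8^(n) is closed under the Weyl reflections in all roots ρ ∈ Φ_O. -/
noncomputable section

open Finset

attribute [local instance] Classical.propDecidable

/-- Standard inner product on ℝ^N. -/
def inn {N : ℕ} (x y : Fin N → ℝ) : ℝ := ∑ i, x i * y i

/-- Standard basis vector k_i (0-indexed). -/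
def kvec {N : ℕ} (i : Fin N) : Fin N → ℝ := fun j => if j = i then 1 else 0

/-- Φ_O : the roots ±k_i ± k_j, i < j (all four sign choices). -/
def PhiO {N : ℕ} : Set (Fin N → ℝ) :=
  {x | ∃ i j : Fin N, i < j ∧ ∃ s t : ℝ, (s = 1 ∨ s = -1) ∧ (t = 1 ∨ t = -1) ∧
    x = s • kvec i + t • kvec j}

/-- Φ_S : the roots (1/2)(ε_1 k_1 + ⋯ + ε_N k_N), each ε_i = ±1, an even number of ε_i = +1. -/
def PhiS {N : ℕ} : Set (Fin N → ℝ) :=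
  {x | ∃ ε : Fin N → ℝ, (∀ i, ε i = 1 ∨ ε i = -1) ∧
    Even ((Finset.univ.filter fun i => ε i = 1).card) ∧
    x = fun i => ε i / 2}

/-- The set of extended roots of e8^(n) (with N = 4(n+1)). -/
def Phi {N : ℕ} : Set (Fin N → ℝ) := PhiO ∪ PhiS

lemma mem_PhiO_of_ne {N : ℕ} {i j : Fin N} (hij : i ≠ j) {s t : ℝ}
    (hs : s = 1 ∨ s = -1) (ht : t = 1 ∨ t = -1) :
    s • kvec i + t • kvec j ∈ (PhiO : Set (Fin N → ℝ)) := by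
  rcases lt_or_gt_of_ne hij with h | h
  · exact ⟨i, j, h, s, t, hs, ht, rfl⟩
  · exact ⟨j, i, h, t, s, ht, hs, add_comm _ _⟩

lemma inn_root {N : ℕ} (x : Fin N → ℝ) (i j : Fin N) (s t : ℝ) :
    inn x (s • kvec i + t • kvec j) = s * x i + t * x j := by
  simp [inn, kvec, mul_add, Finset.sum_add_distrib, mul_comm]

lemma mul_eq_one_or_neg_one {a b : ℝ} (ha : a = 1 ∨ a = -1) (hb : b = 1 ∨ b = -1) :
    a * b = 1 ∨ a * b = -1 := by
  rcases ha with rfl | rfl <;> rcases hb with rfl | rfl <;> norm_num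

lemma even_card_filter_iff_prod_neg {N : ℕ} {ε : Fin N → ℝ} (hε : ∀ i, ε i = 1 ∨ ε i = -1) :
    Even ((Finset.univ.filter fun i => ε i = 1).card) ↔ ∏ i, -ε i = 1 := by
  have h : ∏ i, -ε i = (-1) ^ (Finset.univ.filter fun i => ε i = 1).card := by
    rw [← Finset.prod_const, Finset.prod_filter]
    refine Finset.prod_congr rfl fun i _ => ?_
    rcases hε i with h | h <;> norm_num [h]
  rw [h, neg_one_pow_eq_one_iff_even (by norm_num)]

/-- The factor by which the reflection in `s • kvec i + t • kvec j` multiplies the `m`-th coordinate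
after exchanging the coordinates `i` and `j`, where `u = -(s * t)`. -/
def reflSign {N : ℕ} (i j : Fin N) (u : ℝ) (m : Fin N) : ℝ :=
  (if m = i then u else 1) * (if m = j then u else 1)

lemma reflSign_eq {N : ℕ} (i j : Fin N) {u : ℝ} (hu : u = 1 ∨ u = -1) (m : Fin N) :
    reflSign i j u m = 1 ∨ reflSign i j u m = -1 := by
  apply mul_eq_one_or_neg_one <;> split_ifs <;> simp [hu]

lemma prod_reflSign {N : ℕ} (i j : Fin N) {u : ℝ} (hu : u = 1 ∨ u = -1) :
    ∏ m, reflSign i j u m = 1 := by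
  simp only [reflSign, Finset.prod_mul_distrib, Finset.prod_ite_eq', Finset.mem_univ, if_true]
  rcases hu with rfl | rfl <;> norm_num

lemma reflection_apply {N : ℕ} {i j : Fin N} (hij : i ≠ j) {s t : ℝ}
    (hs : s = 1 ∨ s = -1) (ht : t = 1 ∨ t = -1) (x : Fin N → ℝ) :
    x - (2 * inn x (s • kvec i + t • kvec j) /
        inn (s • kvec i + t • kvec j) (s • kvec i + t • kvec j)) • (s • kvec i + t • kvec j) =
      fun m => reflSign i j (-(s * t)) m * x (Equiv.swap i j m) := by
  have hs2 : s * s = 1 := by rcases hs with rfl | rfl <;> norm_num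
  have ht2 : t * t = 1 := by rcases ht with rfl | rfl <;> norm_num
  have hρ : inn (s • kvec i + t • kvec j) (s • kvec i + t • kvec j) = 2 := by
    rw [inn_root]
    simp only [kvec, Pi.add_apply, Pi.smul_apply, smul_eq_mul, if_true, if_neg hij,
      if_neg hij.symm]
    linarith
  rw [hρ, inn_root, mul_div_cancel_left₀ _ two_ne_zero]
  funext m
  simp only [kvec, reflSign, Pi.sub_apply, Pi.add_apply, Pi.smul_apply, smul_eq_mul]
  by_cases hi : m = i
  · subst hi
    simp only [if_true, if_neg hij, Equiv.swap_apply_left]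
    linear_combination -x m * hs2
  · by_cases hj : m = j
    · subst hj
      simp only [if_true, if_neg hi, Equiv.swap_apply_right]
      linear_combination -x m * ht2
    · simp [hi, hj, Equiv.swap_apply_of_ne_of_ne hi hj]

lemma signed_perm_mem_PhiO {N : ℕ} {c : Fin N → ℝ} (hc : ∀ m, c m = 1 ∨ c m = -1)
    (σ : Equiv.Perm (Fin N)) {x : Fin N → ℝ} (hx : x ∈ (PhiO : Set (Fin N → ℝ))) :
    (fun m => c m * x (σ m)) ∈ (PhiO : Set (Fin N → ℝ)) := by
  obtain ⟨a, b, hab, s, t, hs, ht, rfl⟩ := hx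
  convert mem_PhiO_of_ne (σ.symm.injective.ne hab.ne) (mul_eq_one_or_neg_one (hc (σ.symm a)) hs)
    (mul_eq_one_or_neg_one (hc (σ.symm b)) ht) using 1
  have key : ∀ m d, c m * kvec d (σ m) = c (σ.symm d) * kvec (σ.symm d) m := by
    intro m d
    simp only [kvec, ← Equiv.eq_symm_apply]
    split_ifs with h <;> simp [h]
  funext m
  simp only [Pi.add_apply, Pi.smul_apply, smul_eq_mul]
  linear_combination s * key m a + t * key m b

lemma signed_perm_mem_PhiS {N : ℕ} {c : Fin N → ℝ} (hc : ∀ m, c m = 1 ∨ c m = -1)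
    (hprod : ∏ m, c m = 1) (σ : Equiv.Perm (Fin N)) {x : Fin N → ℝ}
    (hx : x ∈ (PhiS : Set (Fin N → ℝ))) :
    (fun m => c m * x (σ m)) ∈ (PhiS : Set (Fin N → ℝ)) := by
  obtain ⟨ε, hε, heven, rfl⟩ := hx
  have hε' : ∀ m, c m * ε (σ m) = 1 ∨ c m * ε (σ m) = -1 := fun m => mul_eq_one_or_neg_one (hc m) (hε _)
  refine ⟨fun m => c m * ε (σ m), hε', ?_, by funext m; ring⟩
  rw [even_card_filter_iff_prod_neg hε] at heven
  rw [even_card_filter_iff_prod_neg hε']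
  simp only [← mul_neg, Finset.prod_mul_distrib, hprod, one_mul]
  rw [Equiv.prod_comp σ fun m => -ε m, heven]

/-- Φ is closed under the Weyl reflections in all roots ρ ∈ Φ_O. -/
theorem stmt1 (n : ℕ) (hn : 1 ≤ n) (ρ x : Fin (4*(n+1)) → ℝ)
    (hρ : ρ ∈ (PhiO : Set (Fin (4*(n+1)) → ℝ)))
    (hx : x ∈ (Phi : Set (Fin (4*(n+1)) → ℝ))) :
    x - (2 * inn x ρ / inn ρ ρ) • ρ ∈ (Phi : Set (Fin (4*(n+1)) → ℝ)) := by
  obtain ⟨i, j, hij, s, t, hs, ht, rfl⟩ := hρ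
  have hu : -(s * t) = 1 ∨ -(s * t) = -1 := by
    rcases hs with rfl | rfl <;> rcases ht with rfl | rfl <;> norm_num
  rw [reflection_apply hij.ne hs ht]
  rcases hx with hx | hx
  · exact Or.inl (signed_perm_mem_PhiO (reflSign_eq i j hu) _ hx)
  · exact Or.inr (signed_perm_mem_PhiS (reflSign_eq i j hu) (prod_reflSign i j hu) _ hx)
end
end

section
/- If n ≥ 2, then the set of extended roots Φ of e8^(n) is not closed under Weyl reflections in all of its elements: there exist ρ ∈ Φ_S and x ∈ Φ_S such that x − 2((x,ρ)/(ρ,ρ))ρ ∉ Φ. (Combined with closure under reflections in Φ_O, Φ is closed under the Weyl reflections in all of its elements if and only if n = 1.) -/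
noncomputable section

open Finset

attribute [local instance] Classical.propDecidable

/-- The sign vector `(-1, -1, 1, …, 1)`. -/
def flipTwo (N : ℕ) : Fin N → ℝ := fun i => if i.val < 2 then -1 else 1

lemma even_card_flipTwo (M : ℕ) (hM : Even M) :
    Even ((Finset.univ.filter fun i => flipTwo (M + 2) i = 1).card) := by
  rw [Finset.card_filter, Fin.sum_univ_succ, Fin.sum_univ_succ]
  have h : ∀ i : Fin M, flipTwo (M + 2) i.succ.succ = 1 := fun i => by simp [flipTwo]
  have h₀ : flipTwo (M + 2) 0 ≠ 1 := by norm_num [flipTwo]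
  have h₁ : flipTwo (M + 2) (Fin.succ 0) ≠ 1 := by norm_num [flipTwo]
  simpa only [h, h₀, h₁, if_true, if_false, zero_add, Finset.sum_const, Finset.card_univ,
    Fintype.card_fin, smul_eq_mul, mul_one] using hM

lemma inn_flipTwo_const (M : ℕ) :
    inn (fun i => flipTwo (M + 2) i / 2) (fun _ => 1 / 2) = ((M : ℝ) - 2) / 4 := by
  rw [inn, Fin.sum_univ_succ, Fin.sum_univ_succ]
  have h : ∀ i : Fin M, flipTwo (M + 2) i.succ.succ = 1 := fun i => by simp [flipTwo]
  have h₀ : flipTwo (M + 2) 0 = -1 := by norm_num [flipTwo]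
  have h₁ : flipTwo (M + 2) (Fin.succ 0) = -1 := by norm_num [flipTwo]
  simp only [h, h₀, h₁, Finset.sum_const, Finset.card_univ, Fintype.card_fin, nsmul_eq_mul]
  ring

lemma inn_const_half (N : ℕ) :
    inn (fun _ : Fin N => (1 / 2 : ℝ)) (fun _ => 1 / 2) = (N : ℝ) / 4 := by
  simp only [inn, Finset.sum_const, Finset.card_univ, Fintype.card_fin, nsmul_eq_mul]
  ring

lemma notMem_Phi_of_coord {N : ℕ} (v : Fin N → ℝ) (k : Fin N)
    (hlow : -(1 / 2) < v k) (hneg : v k < 0) : v ∉ (Phi : Set (Fin N → ℝ)) := by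
  rintro (⟨i, j, hij, s, t, hs, ht, rfl⟩ | ⟨ε, hε, -, rfl⟩)
  · simp only [Pi.add_apply, Pi.smul_apply, kvec, smul_eq_mul] at hlow hneg
    rcases hs with rfl | rfl <;> rcases ht with rfl | rfl <;> split_ifs at hlow hneg <;> linarith
  · rcases hε k with h | h <;> simp only [h] at hlow hneg <;> linarith

/-- For n ≥ 2, Φ is not closed under Weyl reflections in all of its elements:
there are ρ, x ∈ Φ_S with w_ρ(x) ∉ Φ. -/
theorem stmt2 (n : ℕ) (hn : 2 ≤ n) :
    ∃ ρ ∈ (PhiS : Set (Fin (4*(n+1)) → ℝ)), ∃ x ∈ (PhiS : Set (Fin (4*(n+1)) → ℝ)),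
      x - (2 * inn x ρ / inn ρ ρ) • ρ ∉ (Phi : Set (Fin (4*(n+1)) → ℝ)) := by
  have hn' : (2 : ℝ) ≤ n := by exact_mod_cast hn
  have hρ : inn (fun _ : Fin (4*(n+1)) => (1 / 2 : ℝ)) (fun _ => 1 / 2) = n + 1 := by
    rw [inn_const_half]
    push_cast
    ring
  have hx : inn (fun i => flipTwo (4*(n+1)) i / 2) (fun _ => 1 / 2) = (n : ℝ) := by
    refine (inn_flipTwo_const (4 * n + 2)).trans ?_
    push_cast
    ring
  refine ⟨fun _ => 1 / 2, ⟨fun _ => 1, fun _ => Or.inl rfl, ?_, rfl⟩,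
    fun i => flipTwo _ i / 2, ⟨flipTwo _, fun i => ?_, ?_, rfl⟩, ?_⟩
  · simp [parity_simps, show Even 4 by decide]
  · unfold flipTwo
    split_ifs <;> simp
  · exact even_card_flipTwo (4 * n + 2) ⟨2 * n + 1, by ring⟩
  · have hc : (2 * (n : ℝ) / (n + 1)) * (1 / 2) = 1 - 1 / (n + 1) := by
      field_simp
      ring
    have hpos : 0 < 1 / ((n : ℝ) + 1) := by positivity
    have hlt : 1 / ((n : ℝ) + 1) < 1 / 2 := by
      apply one_div_lt_one_div_of_lt <;> linarith
    rw [hx, hρ]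
    apply notMem_Phi_of_coord _ ⟨2, by omega⟩ <;>
      simp only [Pi.sub_apply, Pi.smul_apply, smul_eq_mul, hc, flipTwo,
        lt_irrefl, if_false] <;>
      linarith
end
end

section
/- Every extended root β ∈ Φ of e8^(n) can be written as β = ∑_{i=1}^N ℓ_i α_i with all ℓ_i integers that are either all nonnegative or all nonpositive, where α_1,…,α_N are the simple extended roots. -/
noncomputable section

open Finset

attribute [local instance] Classical.propDecidable

/-- The simple extended roots α_1, …, α_N (0-indexed): for i ≤ N-3 (i.e. α_1,…,α_{N-2}
1-indexed) it is k_i - k_{i+1}; for i = N-2 (i.e. α_{N-1}) it is k_{N-2} + k_{N-1}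
(1-indexed); for i = N-1 (i.e. α_N) it is -(1/2)(k_1 + ⋯ + k_N). -/
def alphaRoot {N : ℕ} (i : Fin N) : Fin N → ℝ :=
  fun j =>
    if (i : ℕ) = N - 1 then -(1/2)
    else if (i : ℕ) = N - 2 then (if (j : ℕ) = N - 3 ∨ (j : ℕ) = N - 2 then 1 else 0)
    else (if (j : ℕ) = (i : ℕ) then 1 else if (j : ℕ) = (i : ℕ) + 1 then -1 else 0)

/-- Coefficientwise form of a combination of the vectors `k_i - k_{i+1}`, `i < M`. -/
lemma sum_mul_consecutive_diff (f : ℕ → ℝ) (M j : ℕ) :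
    ∑ i ∈ range M, f i * (if j = i then 1 else if j = i + 1 then -1 else 0) =
      (if j < M then f j else 0) - (if 1 ≤ j ∧ j ≤ M then f (j - 1) else 0) := by
  induction M with
  | zero =>
    have : ¬ (1 ≤ j ∧ j ≤ 0) := by omega
    rw [if_neg this]
    simp
  | succ M ih =>
    rw [sum_range_succ, ih]
    rcases lt_trichotomy j M with h | rfl | h
    · have h1 : j < M + 1 := by omega
      have h2 : j ≠ M := by omega
      have h3 : j ≠ M + 1 := by omega
      simp [h, h1, h2, h3, h.le, h1.le]
    · simp
      ring
    · by_cases h1 : j = M + 1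
      · subst h1
        simp
      · have h2 : ¬ j < M + 1 := by omega
        have h3 : ¬ j ≤ M + 1 := by omega
        have h4 : ¬ j ≤ M := by omega
        have h5 : j ≠ M := by omega
        simp [h1, h2, h3, h4, h5, h.not_gt]

/-- Combinations of the simple extended roots with nonnegative integer coefficients. -/
def IsNonnegComb {N : ℕ} (β : Fin N → ℝ) : Prop :=
  ∃ ℓ : Fin N → ℤ, (∀ i, 0 ≤ ℓ i) ∧ β = ∑ i, (ℓ i : ℝ) • alphaRoot i

/-- A vector is a nonnegative integer combination of the simple extended roots as soon as,
after subtracting `m` times the last one, its partial sums are nonnegative integers, the total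
is even, and half the total dominates the last coordinate but one. -/
lemma isNonnegComb_of_partial_sums {N : ℕ} (hN : 3 ≤ N) (β : Fin N → ℝ) (y : ℕ → ℤ) (m T : ℤ)
    (hm : 0 ≤ m) (hβ : ∀ j : Fin N, β j = y j - m / 2) (hlast : y (N - 1) = 0)
    (hpos : ∀ a, 0 ≤ ∑ k ∈ range a, y k) (hT : ∑ k ∈ range N, y k = 2 * T)
    (hle : y (N - 2) ≤ T) : IsNonnegComb β := by
  obtain ⟨M, rfl⟩ := Nat.exists_eq_add_of_le' hN
  have e1 : M + 3 - 1 = M + 2 := by omega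
  have e2 : M + 3 - 2 = M + 1 := by omega
  rw [e1] at hlast
  rw [e2] at hle
  have hT0 : 0 ≤ T := by have := hpos (M + 3); omega
  let S : ℕ → ℤ := fun a => ∑ k ∈ range a, y k
  have hS : ∀ a, S (a + 1) = S a + y a := fun a => sum_range_succ _ _
  have hST : S M + y M + y (M + 1) = 2 * T := by
    rw [← hT, sum_range_succ, sum_range_succ, sum_range_succ, hlast, add_zero]
  have hSTr : (S M : ℝ) + y M + y (M + 1) = 2 * T := by exact_mod_cast hST
  let L : ℕ → ℤ := fun i => if i = M + 2 then m else if i = M + 1 then T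
    else if i = M then T - y (M + 1) else S (i + 1)
  refine ⟨fun i => L i, fun i => ?_, ?_⟩
  · simp only [L]
    split_ifs
    · exact hm
    · exact hT0
    · omega
    · exact hpos _
  · ext j
    rw [Finset.sum_apply, hβ]
    let F : ℕ → ℝ := fun i => (L i : ℝ) *
      (if i = M + 2 then -(1 / 2)
        else if i = M + 1 then (if (j : ℕ) = M ∨ (j : ℕ) = M + 1 then 1 else 0)
        else (if (j : ℕ) = i then 1 else if (j : ℕ) = i + 1 then -1 else 0))
    have hF : ∀ i : Fin (M + 3), ((L i : ℝ) • alphaRoot i) j = F i := fun i => by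
      simp [F, alphaRoot]
    rw [sum_congr rfl fun i _ => hF i, Fin.sum_univ_eq_sum_range F (M + 3), sum_range_succ,
      sum_range_succ, sum_range_succ]
    have hlow : ∑ i ∈ range M, F i = ∑ i ∈ range M, (S (i + 1) : ℝ) *
        (if (j : ℕ) = i then 1 else if (j : ℕ) = i + 1 then -1 else 0) := by
      refine sum_congr rfl fun i hi => ?_
      have hi := mem_range.1 hi
      have h1 : i ≠ M + 2 := by omega
      have h2 : i ≠ M + 1 := by omega
      have h3 : i ≠ M := by omega
      simp [F, L, h1, h2, h3]
    rw [hlow, sum_mul_consecutive_diff (fun i => (S (i + 1) : ℝ))]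
    have hj := j.isLt
    have hS0 : S 0 = 0 := rfl
    simp only [F, L]
    generalize (j : ℕ) = a at hj ⊢
    rcases lt_trichotomy a M with h | rfl | h
    · have h1 : a ≠ M := by omega
      rcases a with _ | a
      · simp [h, h1, hS, hS0]
        ring
      · have h2 : a ≠ M := by omega
        simp [h, h1, h2, hS, h.le]
        ring
    · rcases a with _ | a
      · simp [hS0] at hSTr ⊢
        linarith
      · simp
        linarith
    · obtain rfl | rfl : a = M + 1 ∨ a = M + 2 := by omega
      · simp
        ring
      · simp [hlast]
        ring

lemma isNonnegComb_half_signs {N : ℕ} (hN : 3 ≤ N) (ε : Fin N → ℝ)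
    (hε : ∀ i, ε i = 1 ∨ ε i = -1) (heven : Even (univ.filter fun i => ε i = 1).card)
    (hlast : ε ⟨N - 1, by omega⟩ = -1) : IsNonnegComb fun i => ε i / 2 := by
  obtain ⟨T, hT⟩ := heven
  let y : ℕ → ℤ := fun k => if h : k < N then (if ε ⟨k, h⟩ = 1 then 1 else 0) else 0
  have hy0 : ∀ k, 0 ≤ y k := fun k => by simp only [y]; split_ifs <;> simp
  have hy1 : ∀ k, y k ≤ 1 := fun k => by simp only [y]; split_ifs <;> simp
  have hsum : ∑ k ∈ range N, y k = 2 * (T : ℤ) := by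
    rw [← Fin.sum_univ_eq_sum_range]
    have : ∀ i : Fin N, y i = if ε i = 1 then 1 else 0 := fun i => by simp [y]
    rw [sum_congr rfl fun i _ => this i, sum_boole, hT]
    push_cast
    ring
  refine isNonnegComb_of_partial_sums hN _ y 1 T zero_le_one (fun j => ?_) ?_
    (fun a => sum_nonneg fun k _ => hy0 k) hsum ?_
  · rcases hε j with h | h <;> norm_num [y, h]
  · have : N - 1 < N := by omega
    norm_num [y, this, hlast]
  · have h1 : y (N - 2) ≤ ∑ k ∈ range N, y k :=
      single_le_sum (fun k _ => hy0 k) (mem_range.2 (by omega))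
    have := hy0 (N - 2)
    have := hy1 (N - 2)
    omega

lemma sum_range_ite_eq (s : ℤ) (a i : ℕ) :
    ∑ k ∈ range a, (if k = i then s else 0) = if i < a then s else 0 := by
  simp [sum_ite_eq']

lemma isNonnegComb_kvec_add {N : ℕ} (hN : 3 ≤ N) (i j : Fin N) (hij : i < j)
    (hj : (j : ℕ) < N - 1) (t : ℤ) (ht : t = 1 ∨ t = -1) :
    IsNonnegComb (kvec i + (t : ℝ) • kvec j) := by
  have hij' : (i : ℕ) < j := hij
  let y : ℕ → ℤ := fun k => (if k = i then 1 else 0) + (if k = j then t else 0)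
  have hsum : ∀ a, ∑ k ∈ range a, y k =
      (if (i : ℕ) < a then 1 else 0) + (if (j : ℕ) < a then t else 0) := fun a => by
    simp only [y, sum_add_distrib, sum_range_ite_eq]
  have key : ∃ T, 1 + t = 2 * T ∧ 0 ≤ T ∧ t ≤ T := by
    rcases ht with rfl | rfl
    · exact ⟨1, by norm_num⟩
    · exact ⟨0, by norm_num⟩
  obtain ⟨T, hT, hT0, htT⟩ := key
  refine isNonnegComb_of_partial_sums hN _ y 0 T le_rfl (fun k => ?_) ?_ (fun a => ?_) ?_ ?_
  · simp [y, kvec, Fin.ext_iff]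
  · simp only [y]
    rw [if_neg (by omega), if_neg (by omega), add_zero]
  · rw [hsum]
    split_ifs <;> omega
  · rw [hsum, if_pos i.isLt, if_pos j.isLt, hT]
  · simp only [y]
    rw [if_neg (by omega)]
    split_ifs <;> omega

lemma isNonnegComb_kvec_sub_last {N : ℕ} (hN : 6 ≤ N) (hNe : Even N) (i j : Fin N) (hij : i < j)
    (hj : (j : ℕ) = N - 1) (s : ℤ) (hs : s = 1 ∨ s = -1) :
    IsNonnegComb ((s : ℝ) • kvec i - kvec j) := by
  have hij' : (i : ℕ) < j := hij
  let y : ℕ → ℤ := fun k => if k < N then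
    1 + (if k = i then s else 0) + (if k = j then -1 else 0) else 0
  have hsum : ∑ k ∈ range N, y k = N + s - 1 := by
    have : ∀ k ∈ range N, y k = 1 + (if k = i then s else 0) + (if k = j then -1 else 0) :=
      fun k hk => if_pos (mem_range.1 hk)
    rw [sum_congr rfl this, sum_add_distrib, sum_add_distrib, sum_range_ite_eq,
      sum_range_ite_eq, if_pos i.isLt, if_pos j.isLt]
    simp
    ring
  have hy0 : ∀ k, 0 ≤ y k := fun k => by
    simp only [y]
    split_ifs <;> omega
  obtain ⟨c, hc⟩ := hNe
  have key : ∃ T : ℤ, N + s - 1 = 2 * T := by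
    rcases hs with rfl | rfl
    · exact ⟨c, by omega⟩
    · exact ⟨c - 1, by omega⟩
  obtain ⟨T, hT⟩ := key
  refine isNonnegComb_of_partial_sums (by omega) _ y 2 T zero_le_two (fun k => ?_) ?_
    (fun a => sum_nonneg fun k _ => hy0 k) (hsum.trans hT) ?_
  · simp only [y, kvec, Fin.ext_iff, Pi.sub_apply, Pi.smul_apply, smul_eq_mul, if_pos k.isLt]
    push_cast
    split_ifs <;> ring
  · simp only [y]
    rw [if_pos (by omega), if_neg (by omega), if_pos (by omega)]
    norm_num
  · simp only [y]
    split_ifs <;> omega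

lemma isNonnegComb_or_neg_of_mem_PhiO {N : ℕ} (hN : 6 ≤ N) (hNe : Even N) {β : Fin N → ℝ}
    (hβ : β ∈ PhiO) : IsNonnegComb β ∨ IsNonnegComb (-β) := by
  obtain ⟨i, j, hij, s, t, hs, ht, rfl⟩ := hβ
  by_cases hj : (j : ℕ) = N - 1
  · have hp := isNonnegComb_kvec_sub_last hN hNe i j hij hj 1 (by simp)
    have hn := isNonnegComb_kvec_sub_last hN hNe i j hij hj (-1) (by simp)
    rcases hs with rfl | rfl <;> rcases ht with rfl | rfl
    · right; convert hn using 1; push_cast; module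
    · left; convert hp using 1; push_cast; module
    · right; convert hp using 1; push_cast; module
    · left; convert hn using 1; push_cast; module
  · have hj' : (j : ℕ) < N - 1 := by omega
    have hp := isNonnegComb_kvec_add (by omega) i j hij hj' 1 (by simp)
    have hn := isNonnegComb_kvec_add (by omega) i j hij hj' (-1) (by simp)
    rcases hs with rfl | rfl <;> rcases ht with rfl | rfl
    · left; convert hp using 1; push_cast; module
    · left; convert hn using 1; push_cast; module
    · right; convert hn using 1; push_cast; module
    · right; convert hp using 1; push_cast; module

lemma isNonnegComb_or_neg_of_mem_PhiS {N : ℕ} (hN : 3 ≤ N) (hNe : Even N) {β : Fin N → ℝ}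
    (hβ : β ∈ PhiS) : IsNonnegComb β ∨ IsNonnegComb (-β) := by
  obtain ⟨ε, hε, heven, rfl⟩ := hβ
  rcases hε ⟨N - 1, by omega⟩ with h | h
  · right
    have hcard : (univ.filter fun i => -ε i = 1).card + (univ.filter fun i => ε i = 1).card
        = N := by
      have hneg : (univ.filter fun i => -ε i = 1) = univ.filter fun i => ¬ ε i = 1 := by
        refine filter_congr fun i _ => ?_
        rcases hε i with h | h <;> norm_num [h]
      rw [hneg, add_comm, card_filter_add_card_filter_not, card_univ, Fintype.card_fin]
    have heven' : Even (univ.filter fun i => -ε i = 1).card := by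
      rw [← hcard, Nat.even_add] at hNe
      exact hNe.2 heven
    convert isNonnegComb_half_signs hN (fun i => -ε i)
      (fun i => by rcases hε i with h | h <;> simp [h]) heven' (by simp [h]) using 1
    ext i
    simp [neg_div]
  · exact Or.inl (isNonnegComb_half_signs hN ε hε heven h)

/-- Every extended root β ∈ Φ is an integer linear combination of the simple
extended roots with coefficients all nonnegative or all nonpositive. -/
theorem stmt4 (n : ℕ) (hn : 1 ≤ n) (β : Fin (4*(n+1)) → ℝ)
    (hβ : β ∈ (Phi : Set (Fin (4*(n+1)) → ℝ))) :
    ∃ ℓ : Fin (4*(n+1)) → ℤ, ((∀ i, 0 ≤ ℓ i) ∨ (∀ i, ℓ i ≤ 0)) ∧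
      β = ∑ i, (ℓ i : ℝ) • alphaRoot i := by
  have hN : 6 ≤ 4 * (n + 1) := by omega
  have hNe : Even (4 * (n + 1)) := ⟨2 * (n + 1), by ring⟩
  have h : IsNonnegComb β ∨ IsNonnegComb (-β) := hβ.elim
    (isNonnegComb_or_neg_of_mem_PhiO hN hNe) (isNonnegComb_or_neg_of_mem_PhiS (by omega) hNe)
  rcases h with ⟨ℓ, hℓ, h⟩ | ⟨ℓ, hℓ, h⟩
  · exact ⟨ℓ, Or.inl hℓ, h⟩
  · refine ⟨fun i => -ℓ i, Or.inr fun i => neg_nonpos.2 (hℓ i), ?_⟩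
    rw [← neg_neg β, h, ← sum_neg_distrib]
    simp
end
end

section
/- For every α ∈ Φ_O and every β ∈ Φ: α + β ∈ Φ if and only if (α,β) = −1, and α − β ∈ Φ if and only if (α,β) = +1. -/
noncomputable section

open Finset

attribute [local instance] Classical.propDecidable

theorem inn_add_self {N : ℕ} (x y : Fin N → ℝ) :
    inn (x + y) (x + y) = inn x x + 2 * inn x y + inn y y := by
  simp only [inn, Finset.mul_sum, ← Finset.sum_add_distrib]
  exact Finset.sum_congr rfl fun i _ => by simp only [Pi.add_apply]; ring

theorem inn_neg_right {N : ℕ} (x y : Fin N → ℝ) : inn x (-y) = -inn x y := by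
  simp [inn]

/-- The inner product of `s k_i + t k_j` with `y` reads off two coordinates of `y`. -/
theorem inn_kvec_add_kvec {N : ℕ} (i j : Fin N) (s t : ℝ) (y : Fin N → ℝ) :
    inn (s • kvec i + t • kvec j) y = s * y i + t * y j := by
  simp [inn, kvec, add_mul, Finset.sum_add_distrib]

/-- `Φ_O` consists of the integral vectors of squared length two. -/
theorem mem_PhiO_iff {N : ℕ} {x : Fin N → ℝ} :
    x ∈ (PhiO : Set (Fin N → ℝ)) ↔ (∃ z : Fin N → ℤ, ∀ i, x i = z i) ∧ inn x x = 2 := by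
  constructor
  · rintro ⟨i, j, hij, s, t, hs, ht, rfl⟩
    constructor
    · obtain ⟨a, rfl⟩ : ∃ a : ℤ, s = a := by
        rcases hs with rfl | rfl
        · exact ⟨1, by simp⟩
        · exact ⟨-1, by simp⟩
      obtain ⟨b, rfl⟩ : ∃ b : ℤ, t = b := by
        rcases ht with rfl | rfl
        · exact ⟨1, by simp⟩
        · exact ⟨-1, by simp⟩
      exact ⟨fun k => a * (if k = i then 1 else 0) + b * (if k = j then 1 else 0),
        fun k => by simp [kvec]⟩
    · rw [inn_kvec_add_kvec]
      rcases hs with rfl | rfl <;> rcases ht with rfl | rfl <;>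
        norm_num [kvec, hij.ne, hij.ne']
  · rintro ⟨⟨z, hz⟩, h⟩
    have hsum : ∑ i, z i * z i = 2 := by
      simp only [inn, hz] at h
      exact_mod_cast h
    have hle (i : Fin N) : z i * z i ≤ 2 :=
      hsum ▸ Finset.single_le_sum (f := fun i => z i * z i)
        (fun k _ => mul_self_nonneg (z k)) (Finset.mem_univ i)
    have hval (i : Fin N) : z i = 0 ∨ z i = 1 ∨ z i = -1 := by
      have h₁ : z i ≤ 1 := by nlinarith [hle i]
      have h₂ : -1 ≤ z i := by nlinarith [hle i]
      omega
    have hcard : (Finset.univ.filter fun i => z i ≠ 0).card = 2 := by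
      have : ∑ i, z i * z i = ((Finset.univ.filter fun i => z i ≠ 0).card : ℤ) := by
        rw [Finset.card_filter, Nat.cast_sum]
        refine Finset.sum_congr rfl fun i _ => ?_
        rcases hval i with h | h | h <;> simp [h]
      exact_mod_cast this.symm.trans hsum
    have key (i j : Fin N) (hij : i < j) (hs : ∀ k, z k ≠ 0 ↔ k = i ∨ k = j) :
        x ∈ (PhiO : Set (Fin N → ℝ)) := by
      have hone (k : Fin N) (hk : z k ≠ 0) : x k = 1 ∨ x k = -1 := by
        rcases hval k with h | h | h
        · exact absurd h hk
        · simp [hz, h]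
        · simp [hz, h]
      refine ⟨i, j, hij, x i, x j, hone i ((hs i).2 (Or.inl rfl)),
        hone j ((hs j).2 (Or.inr rfl)), ?_⟩
      funext k
      by_cases hki : k = i
      · subst hki; simp [kvec, hij.ne]
      by_cases hkj : k = j
      · subst hkj; simp [kvec, hij.ne']
      have : z k = 0 := by
        by_contra hk
        rcases (hs k).1 hk with h | h <;> contradiction
      simp [kvec, hki, hkj, hz k, this]
    obtain ⟨i, j, hij, hs⟩ := Finset.card_eq_two.1 hcard
    have hs' (k : Fin N) : z k ≠ 0 ↔ k = i ∨ k = j := by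
      simpa using congrArg (k ∈ ·) hs
    rcases hij.lt_or_gt with h | h
    · exact key i j h hs'
    · exact key j i h fun k => (hs' k).trans or_comm

/-- `Φ_S` consists of the vectors with entries `±1/2` and an even number of positive entries. -/
theorem mem_PhiS_iff {N : ℕ} {x : Fin N → ℝ} :
    x ∈ (PhiS : Set (Fin N → ℝ)) ↔
      (∀ i, x i = 1 / 2 ∨ x i = -1 / 2) ∧ ∃ m : ℤ, ∑ i, (x i + 1 / 2) = 2 * m := by
  have hcard (ε : Fin N → ℝ) (hε : ∀ i, ε i = 1 ∨ ε i = -1) :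
      ∑ i, (ε i / 2 + 1 / 2) = ((Finset.univ.filter fun i => ε i = 1).card : ℝ) := by
    rw [Finset.card_filter, Nat.cast_sum]
    refine Finset.sum_congr rfl fun i _ => ?_
    rcases hε i with h | h <;> norm_num [h]
  constructor
  · rintro ⟨ε, hε, ⟨m, hm⟩, rfl⟩
    refine ⟨fun i => ?_, m, ?_⟩
    · rcases hε i with h | h <;> simp [h]
    · rw [hcard ε hε, hm]
      push_cast
      ring
  · rintro ⟨hx, m, hm⟩
    have hε : ∀ i, 2 * x i = 1 ∨ 2 * x i = -1 := fun i => by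
      rcases hx i with h | h <;> norm_num [h]
    refine ⟨fun i => 2 * x i, hε, ?_, by funext i; ring⟩
    have h := hcard _ hε
    simp only [mul_div_cancel_left₀ _ (two_ne_zero' ℝ), hm] at h
    have h' : 2 * m = ((Finset.univ.filter fun i => 2 * x i = 1).card : ℤ) := by
      exact_mod_cast h
    rw [← Int.even_coe_nat, ← h']
    exact even_two_mul m

theorem inn_self_of_mem_PhiS {N : ℕ} {x : Fin N → ℝ} (hx : x ∈ (PhiS : Set (Fin N → ℝ))) :
    inn x x = N / 4 := by
  have h (i : Fin N) : x i * x i = 1 / 4 := by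
    rcases (mem_PhiS_iff.1 hx).1 i with h | h <;> norm_num [h]
  simp [inn, h, div_eq_mul_inv]

/-- No vector with an entry `±1/2` is integral. -/
theorem ne_intCast_of_mem_PhiS {N : ℕ} {x : Fin N → ℝ} (hx : x ∈ (PhiS : Set (Fin N → ℝ)))
    (i : Fin N) (a : ℤ) : x i ≠ a := by
  intro ha
  rcases (mem_PhiS_iff.1 hx).1 i with h | h
  · have : (2 * a : ℝ) = 1 := by linarith
    have : 2 * a = 1 := by exact_mod_cast this
    omega
  · have : (2 * a : ℝ) = -1 := by linarith
    have : 2 * a = -1 := by exact_mod_cast this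
    omega

theorem neg_mem_PhiO {N : ℕ} {x : Fin N → ℝ} (hx : x ∈ (PhiO : Set (Fin N → ℝ))) :
    -x ∈ (PhiO : Set (Fin N → ℝ)) := by
  obtain ⟨⟨z, hz⟩, h⟩ := mem_PhiO_iff.1 hx
  exact mem_PhiO_iff.2 ⟨⟨-z, fun i => by simp [hz]⟩, by simpa [inn] using h⟩

theorem neg_mem_PhiS {N : ℕ} (hN : Even N) {x : Fin N → ℝ}
    (hx : x ∈ (PhiS : Set (Fin N → ℝ))) : -x ∈ (PhiS : Set (Fin N → ℝ)) := by
  obtain ⟨h, m, hm⟩ := mem_PhiS_iff.1 hx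
  obtain ⟨r, rfl⟩ := hN
  refine mem_PhiS_iff.2 ⟨fun i => ?_, r - m, ?_⟩
  · rcases h i with h | h <;> norm_num [h]
  · have : ∑ i, ((-x) i + 1 / 2) = ∑ i, (1 - (x i + 1 / 2)) :=
      Finset.sum_congr rfl fun i _ => by simp only [Pi.neg_apply]; ring
    rw [this, Finset.sum_sub_distrib, hm]
    simp
    ring

theorem neg_mem_Phi {N : ℕ} (hN : Even N) {x : Fin N → ℝ}
    (hx : x ∈ (Phi : Set (Fin N → ℝ))) : -x ∈ (Phi : Set (Fin N → ℝ)) :=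
  hx.imp neg_mem_PhiO (neg_mem_PhiS hN)

theorem add_mem_PhiS {N : ℕ} {α β : Fin N → ℝ} (hα : α ∈ (PhiO : Set (Fin N → ℝ)))
    (hβ : β ∈ (PhiS : Set (Fin N → ℝ))) (h : inn α β = -1) :
    α + β ∈ (PhiS : Set (Fin N → ℝ)) := by
  obtain ⟨i, j, hij, s, t, hs, ht, rfl⟩ := hα
  obtain ⟨hb, m, hm⟩ := mem_PhiS_iff.1 hβ
  rw [inn_kvec_add_kvec] at h
  have hi : β i = -s / 2 := by
    rcases hs with rfl | rfl <;> rcases ht with rfl | rfl <;>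
      rcases hb i with h₁ | h₁ <;> rcases hb j with h₂ | h₂ <;>
      rw [h₁, h₂] at h <;> norm_num at h <;> norm_num [h₁]
  have hj : β j = -t / 2 := by
    rcases hs with rfl | rfl <;> rcases ht with rfl | rfl <;>
      rcases hb i with h₁ | h₁ <;> rcases hb j with h₂ | h₂ <;>
      rw [h₁, h₂] at h <;> norm_num at h <;> norm_num [h₂]
  refine mem_PhiS_iff.2 ⟨fun k => ?_, ?_⟩
  · by_cases hki : k = i
    · subst hki
      rcases hs with rfl | rfl <;> norm_num [kvec, hij.ne, hi]
    by_cases hkj : k = j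
    · subst hkj
      rcases ht with rfl | rfl <;> norm_num [kvec, hij.ne', hj]
    simpa [kvec, hki, hkj] using hb k
  · have hsum : ∑ k, ((s • kvec i + t • kvec j + β) k + 1 / 2) = s + t + 2 * m := by
      rw [← hm]
      simp [kvec, Finset.sum_add_distrib, add_assoc]
    rw [hsum]
    rcases hs with rfl | rfl <;> rcases ht with rfl | rfl
    · exact ⟨m + 1, by push_cast; ring⟩
    · exact ⟨m, by ring⟩
    · exact ⟨m, by ring⟩
    · exact ⟨m - 1, by push_cast; ring⟩

theorem add_mem_Phi_iff {N : ℕ} {α β : Fin N → ℝ} (hα : α ∈ (PhiO : Set (Fin N → ℝ)))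
    (hβ : β ∈ (Phi : Set (Fin N → ℝ))) :
    α + β ∈ (Phi : Set (Fin N → ℝ)) ↔ inn α β = -1 := by
  obtain ⟨i, -⟩ := id hα
  obtain ⟨⟨a, ha⟩, hαα⟩ := mem_PhiO_iff.1 hα
  have hadd := inn_add_self α β
  rcases hβ with hβ | hβ
  · obtain ⟨⟨b, hb⟩, hββ⟩ := mem_PhiO_iff.1 hβ
    have hab (k : Fin N) : (α + β) k = ((a k + b k : ℤ) : ℝ) := by simp [ha, hb]
    constructor
    · rintro (h | h)
      · linarith [(mem_PhiO_iff.1 h).2]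
      · exact absurd (hab i) (ne_intCast_of_mem_PhiS h i _)
    · intro h
      exact Or.inl (mem_PhiO_iff.2 ⟨⟨fun k => a k + b k, hab⟩, by linarith⟩)
  · constructor
    · rintro (h | h)
      · obtain ⟨⟨c, hc⟩, -⟩ := mem_PhiO_iff.1 h
        refine absurd ?_ (ne_intCast_of_mem_PhiS hβ i (c i - a i))
        have := hc i
        rw [Pi.add_apply, ha] at this
        push_cast
        linarith
      · linarith [inn_self_of_mem_PhiS h, inn_self_of_mem_PhiS hβ]
    · exact fun h => Or.inr (add_mem_PhiS hα hβ h)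

/-- For α ∈ Φ_O and β ∈ Φ: α + β ∈ Φ iff (α,β) = -1, and α - β ∈ Φ iff (α,β) = 1. -/
theorem stmt7 (n : ℕ) (hn : 1 ≤ n) (α β : Fin (4*(n+1)) → ℝ)
    (hα : α ∈ (PhiO : Set (Fin (4*(n+1)) → ℝ)))
    (hβ : β ∈ (Phi : Set (Fin (4*(n+1)) → ℝ))) :
    (α + β ∈ (Phi : Set (Fin (4*(n+1)) → ℝ)) ↔ inn α β = -1) ∧
    (α - β ∈ (Phi : Set (Fin (4*(n+1)) → ℝ)) ↔ inn α β = 1) := by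
  have hN : Even (4 * (n + 1)) := ⟨2 * (n + 1), by ring⟩
  refine ⟨add_mem_Phi_iff hα hβ, ?_⟩
  rw [sub_eq_add_neg, add_mem_Phi_iff hα (neg_mem_Phi hN hβ), inn_neg_right, neg_inj]
end
end

section
/- For all α, β ∈ Φ_S: α + β ∈ Φ if and only if (α,β) = −n, and α − β ∈ Φ if and only if (α,β) = n (and in either case the sum, respectively the difference, lies in Φ_O). -/
noncomputable section

open Finset

attribute [local instance] Classical.propDecidable

theorem inn_self_of_mem_PhiO {N : ℕ} {x : Fin N → ℝ} (hx : x ∈ (PhiO : Set (Fin N → ℝ))) :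
    inn x x = 2 := by
  obtain ⟨i, j, hij, s, t, hs, ht, rfl⟩ := hx
  have hne : i ≠ j := hij.ne
  have hss : s * s = 1 := by rcases hs with rfl | rfl <;> norm_num
  have htt : t * t = 1 := by rcases ht with rfl | rfl <;> norm_num
  have key : ∀ k : Fin N, (s • kvec i + t • kvec j : Fin N → ℝ) k *
      (s • kvec i + t • kvec j : Fin N → ℝ) k =
      (if k = i then 1 else 0) + (if k = j then 1 else 0) := by
    intro k
    by_cases h1 : k = i
    · have h2 : k ≠ j := h1 ▸ hne
      simp [kvec, h1, hne, hss]
    · by_cases h2 : k = j <;> simp [kvec, h1, h2, hne.symm, htt]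
  simp only [inn, key, sum_add_distrib, sum_ite_eq', mem_univ, if_true]
  norm_num

theorem mem_PhiO_of_inn_self {N : ℕ} {x : Fin N → ℝ}
    (hx : ∀ i, x i = 0 ∨ x i = 1 ∨ x i = -1) (h : inn x x = 2) :
    x ∈ (PhiO : Set (Fin N → ℝ)) := by
  have key : ∀ i, x i * x i = if x i ≠ 0 then 1 else 0 := by
    intro i
    rcases hx i with h | h | h <;> simp [h]
  have hcard : (univ.filter fun i => x i ≠ 0).card = 2 := by
    have : ((univ.filter fun i => x i ≠ 0).card : ℝ) = 2 := by
      rw [← h, inn, sum_congr rfl fun i _ => key i, sum_boole]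
    exact_mod_cast this
  have main : ∀ i j : Fin N, i < j → (∀ k, x k ≠ 0 ↔ k = i ∨ k = j) →
      x ∈ (PhiO : Set (Fin N → ℝ)) := by
    intro i j hij hk
    refine ⟨i, j, hij, x i, x j, (hx i).resolve_left ((hk i).2 (Or.inl rfl)),
      (hx j).resolve_left ((hk j).2 (Or.inr rfl)), ?_⟩
    funext k
    by_cases h1 : k = i
    · subst h1
      simp [kvec, hij.ne]
    · by_cases h2 : k = j
      · subst h2
        simp [kvec, h1]
      · have : x k = 0 := by
          by_contra h0
          exact ((hk k).1 h0).elim h1 h2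
        simp [kvec, h1, h2, this]
  obtain ⟨i, j, hij, hs⟩ := card_eq_two.1 hcard
  have hk : ∀ k, x k ≠ 0 ↔ k = i ∨ k = j := by
    intro k
    have := Finset.ext_iff.1 hs k
    simpa using this
  rcases hij.lt_or_gt with hlt | hlt
  · exact main i j hlt hk
  · exact main j i hlt fun k => (hk k).trans or_comm

theorem eq_half_or_of_mem_PhiS {N : ℕ} {x : Fin N → ℝ} (hx : x ∈ (PhiS : Set (Fin N → ℝ)))
    (i : Fin N) : x i = 1 / 2 ∨ x i = -1 / 2 := by
  obtain ⟨ε, hε, -, rfl⟩ := hx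
  rcases hε i with h | h <;> simp [h]

/-- Vectors with all coordinates `±1/2`, irrespective of parity: their sum is an extended root
precisely when their inner product is `-n`, and it then lies in `PhiO`. -/
theorem add_mem_Phi_iff_of_half (n : ℕ) {α β : Fin (4*(n+1)) → ℝ}
    (hα : ∀ i, α i = 1 / 2 ∨ α i = -1 / 2) (hβ : ∀ i, β i = 1 / 2 ∨ β i = -1 / 2) :
    (α + β ∈ (Phi : Set (Fin (4*(n+1)) → ℝ)) ↔ inn α β = -(n : ℝ)) ∧
    (α + β ∈ (Phi : Set (Fin (4*(n+1)) → ℝ)) →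
      α + β ∈ (PhiO : Set (Fin (4*(n+1)) → ℝ))) := by
  have hval : ∀ i, (α + β) i = 0 ∨ (α + β) i = 1 ∨ (α + β) i = -1 := by
    intro i
    rcases hα i with h | h <;> rcases hβ i with h' | h' <;> norm_num [h, h']
  have hO : α + β ∈ (Phi : Set (Fin (4*(n+1)) → ℝ)) →
      α + β ∈ (PhiO : Set (Fin (4*(n+1)) → ℝ)) := by
    rintro (h | h)
    · exact h
    · have h1 := eq_half_or_of_mem_PhiS h 0
      rcases hval 0 with h2 | h2 | h2 <;> rw [h2] at h1 <;> norm_num at h1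
  have hnorm : inn (α + β) (α + β) = 2 * (n + 1) + 2 * inn α β := by
    have key : ∀ i, (α + β) i * (α + β) i = 1 / 2 + 2 * (α i * β i) := by
      intro i
      rcases hα i with h | h <;> rcases hβ i with h' | h' <;> norm_num [h, h']
    simp only [inn, key, sum_add_distrib, ← mul_sum, sum_const, card_univ, Fintype.card_fin,
      nsmul_eq_mul]
    push_cast
    ring
  refine ⟨⟨fun h => ?_, fun h => Or.inl (mem_PhiO_of_inn_self hval ?_)⟩, hO⟩
  · have := inn_self_of_mem_PhiO (hO h)
    linarith
  · rw [hnorm, h]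
    ring

/-- For α, β ∈ Φ_S: α + β ∈ Φ iff (α,β) = -n, and α - β ∈ Φ iff (α,β) = n;
in either case the sum (resp. difference) lies in Φ_O. -/
theorem stmt10 (n : ℕ) (hn : 1 ≤ n) (α β : Fin (4*(n+1)) → ℝ)
    (hα : α ∈ (PhiS : Set (Fin (4*(n+1)) → ℝ)))
    (hβ : β ∈ (PhiS : Set (Fin (4*(n+1)) → ℝ))) :
    (α + β ∈ (Phi : Set (Fin (4*(n+1)) → ℝ)) ↔ inn α β = -(n : ℝ)) ∧
    (α + β ∈ (Phi : Set (Fin (4*(n+1)) → ℝ)) → α + β ∈ (PhiO : Set (Fin (4*(n+1)) → ℝ))) ∧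
    (α - β ∈ (Phi : Set (Fin (4*(n+1)) → ℝ)) ↔ inn α β = (n : ℝ)) ∧
    (α - β ∈ (Phi : Set (Fin (4*(n+1)) → ℝ)) → α - β ∈ (PhiO : Set (Fin (4*(n+1)) → ℝ))) := by
  have hα' := eq_half_or_of_mem_PhiS hα
  have hβ' := eq_half_or_of_mem_PhiS hβ
  have hneg : ∀ i, (-β) i = 1 / 2 ∨ (-β) i = -1 / 2 := by
    intro i
    rcases hβ' i with h | h <;> norm_num [h]
  have hinn : inn α (-β) = -inn α β := by simp [inn]
  obtain ⟨h1, h2⟩ := add_mem_Phi_iff_of_half n hα' hβ'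
  obtain ⟨h3, h4⟩ := add_mem_Phi_iff_of_half n hα' hneg
  rw [hinn, neg_inj, ← sub_eq_add_neg] at h3
  rw [← sub_eq_add_neg] at h4
  exact ⟨h1, h2, h3, h4⟩
end
end

section
/- For all α, β ∈ Φ, if α + β ∈ Φ then α − β ∉ Φ. -/
noncomputable section

open Finset

attribute [local instance] Classical.propDecidable

theorem sum_sq_of_mem_PhiO {N : ℕ} {x : Fin N → ℝ} (hx : x ∈ PhiO) : ∑ i, x i ^ 2 = 2 := by
  obtain ⟨i, j, hij, s, t, hs, ht, rfl⟩ := hx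
  have hs2 : s ^ 2 = 1 := by rcases hs with rfl | rfl <;> norm_num
  have ht2 : t ^ 2 = 1 := by rcases ht with rfl | rfl <;> norm_num
  have key : ∀ l, (s • kvec i + t • kvec j : Fin N → ℝ) l ^ 2
      = (if l = i then 1 else 0) + (if l = j then 1 else 0) := by
    intro l
    by_cases hi : l = i
    · have hj : l ≠ j := by rw [hi]; exact hij.ne
      simp [kvec, hi, hij.ne, hs2]
    · by_cases hj : l = j
      · simp [kvec, hj, hij.ne', ht2]
      · simp [kvec, hi, hj]
  simp only [key, Finset.sum_add_distrib, Finset.sum_ite_eq', Finset.mem_univ, if_true]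
  norm_num

theorem exists_int_of_mem_PhiO {N : ℕ} {x : Fin N → ℝ} (hx : x ∈ PhiO) (l : Fin N) :
    ∃ k : ℤ, x l = k := by
  obtain ⟨i, j, -, s, t, hs, ht, rfl⟩ := hx
  have hs' : ∃ a : ℤ, s = a := by
    rcases hs with rfl | rfl
    exacts [⟨1, by simp⟩, ⟨-1, by simp⟩]
  have ht' : ∃ b : ℤ, t = b := by
    rcases ht with rfl | rfl
    exacts [⟨1, by simp⟩, ⟨-1, by simp⟩]
  obtain ⟨a, rfl⟩ := hs'
  obtain ⟨b, rfl⟩ := ht'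
  exact ⟨a * (if l = i then 1 else 0) + b * (if l = j then 1 else 0), by simp [kvec]⟩

theorem sum_sq_of_mem_PhiS {N : ℕ} {x : Fin N → ℝ} (hx : x ∈ PhiS) :
    ∑ i, x i ^ 2 = N / 4 := by
  obtain ⟨ε, hε, -, rfl⟩ := hx
  have key : ∀ i, (ε i / 2) ^ 2 = 1 / 4 := by
    intro i
    rcases hε i with h | h <;> rw [h] <;> norm_num
  simp only [key, Finset.sum_const, Finset.card_univ, Fintype.card_fin, nsmul_eq_mul]
  ring

theorem exists_int_of_mem_PhiS {N : ℕ} {x : Fin N → ℝ} (hx : x ∈ PhiS) (l : Fin N) :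
    ∃ k : ℤ, x l = k + 1 / 2 := by
  obtain ⟨ε, hε, -, rfl⟩ := hx
  rcases hε l with h | h
  · exact ⟨0, by simp [h]⟩
  · exact ⟨-1, by simp only [h]; norm_num⟩

/-- Doubled coordinates of a root are integers whose parity determines the type, hence the norm,
of the root. -/
theorem parity_and_sum_sq_of_mem_Phi {N : ℕ} {x : Fin N → ℝ} (hx : x ∈ Phi) (l : Fin N) :
    ∃ k : ℤ, 2 * x l = k ∧
      (k % 2 = 0 ∧ ∑ i, x i ^ 2 = 2 ∨ k % 2 = 1 ∧ ∑ i, x i ^ 2 = N / 4) := by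
  rcases hx with hx | hx
  · obtain ⟨k, hk⟩ := exists_int_of_mem_PhiO hx l
    exact ⟨2 * k, by rw [hk]; push_cast; ring, Or.inl ⟨by omega, sum_sq_of_mem_PhiO hx⟩⟩
  · obtain ⟨k, hk⟩ := exists_int_of_mem_PhiS hx l
    exact ⟨2 * k + 1, by rw [hk]; push_cast; ring, Or.inr ⟨by omega, sum_sq_of_mem_PhiS hx⟩⟩

theorem sum_sq_add_add_sum_sq_sub {N : ℕ} (x y : Fin N → ℝ) :
    ∑ i, (x + y) i ^ 2 + ∑ i, (x - y) i ^ 2 = 2 * (∑ i, x i ^ 2 + ∑ i, y i ^ 2) := by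
  rw [← Finset.sum_add_distrib, ← Finset.sum_add_distrib, Finset.mul_sum]
  refine Finset.sum_congr rfl fun i _ => ?_
  simp only [Pi.add_apply, Pi.sub_apply]
  ring

/-- For α, β ∈ Φ, if α + β ∈ Φ then α - β ∉ Φ. -/
theorem stmt11 (n : ℕ) (hn : 1 ≤ n) (α β : Fin (4*(n+1)) → ℝ)
    (hα : α ∈ (Phi : Set (Fin (4*(n+1)) → ℝ)))
    (hβ : β ∈ (Phi : Set (Fin (4*(n+1)) → ℝ)))
    (hs : α + β ∈ (Phi : Set (Fin (4*(n+1)) → ℝ))) :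
    α - β ∉ (Phi : Set (Fin (4*(n+1)) → ℝ)) := by
  intro hd
  have hpar := sum_sq_add_add_sum_sq_sub α β
  let l : Fin (4 * (n + 1)) := ⟨0, by omega⟩
  obtain ⟨a, ha, hA⟩ := parity_and_sum_sq_of_mem_Phi hα l
  obtain ⟨b, hb, hB⟩ := parity_and_sum_sq_of_mem_Phi hβ l
  obtain ⟨c, hc, hC⟩ := parity_and_sum_sq_of_mem_Phi hs l
  obtain ⟨d, hd', hD⟩ := parity_and_sum_sq_of_mem_Phi hd l
  have hcab : c = a + b := by
    have : (c : ℝ) = a + b := by rw [← ha, ← hb, ← hc, Pi.add_apply]; ring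
    exact_mod_cast this
  have hdab : d = a - b := by
    have : (d : ℝ) = a - b := by rw [← ha, ← hb, ← hd', Pi.sub_apply]; ring
    exact_mod_cast this
  have hn' : (1 : ℝ) ≤ n := by exact_mod_cast hn
  have hN : ((4 * (n + 1) : ℕ) : ℝ) / 4 = n + 1 := by push_cast; ring
  rw [hN] at hA hB hC hD
  rcases hA with ⟨ha2, hA⟩ | ⟨ha2, hA⟩ <;> rcases hB with ⟨hb2, hB⟩ | ⟨hb2, hB⟩ <;>
    rcases hC with ⟨hc2, hC⟩ | ⟨hc2, hC⟩ <;> rcases hD with ⟨hd2, hD⟩ | ⟨hd2, hD⟩ <;>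
    first
    | omega
    | (rw [hA, hB, hC, hD] at hpar; linarith)
end
end

section
/- For every α = ∑_{i=1}^N m_i α_i in the lattice L, the quantity e = ((α,α) − m_N²(n−1))/2 is an integer and the asymmetry function satisfies ε(α,α) = (−1)^e. -/
noncomputable section

open Finset

attribute [local instance] Classical.propDecidable

/-- The lattice element with integer coordinates `c` w.r.t. the simple extended roots. -/
def toVec {N : ℕ} (c : Fin N → ℤ) : Fin N → ℝ := ∑ i, (c i : ℝ) • alphaRoot i

/-- The asymmetry function on pairs of simple extended roots: ε(α_i,α_i) = -1,
ε(α_i,α_j) = -1 if α_i + α_j is an extended root and α_i < α_j (i.e. i > j in the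
ordering α_i > α_{i+1}), and +1 otherwise. -/
def epsSign {N : ℕ} (i j : Fin N) : ℤˣ :=
  if i = j then -1
  else if (alphaRoot i + alphaRoot j) ∈ (Phi : Set (Fin N → ℝ)) ∧ j < i then -1
  else 1

/-- The asymmetry function ε : L × L → {-1,1}, written on integer coordinate vectors
w.r.t. the basis of simple extended roots:
ε(α,β) = ∏_{i,j} ε(α_i,α_j)^{ℓ_i m_j} for α = ∑ ℓ_i α_i, β = ∑ m_j α_j. -/
def epsFun {N : ℕ} (l m : Fin N → ℤ) : ℤˣ :=
  ∏ i, ∏ j, (epsSign i j) ^ (l i * m j)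

/-- Adjacency `j < i` in the Dynkin diagram of the simple extended roots. -/
def DynkinAdj (N i j : ℕ) : Prop :=
  (j + 1 = i ∧ i + 3 ≤ N) ∨ (i + 2 = N ∧ j + 4 = N) ∨ (i + 1 = N ∧ j + 2 = N)

/-- The exponent of `-1` in `epsSign i j`, chosen so that its symmetrization is the Cartan matrix
of the Dynkin diagram. -/
def epsExp {N : ℕ} (i j : Fin N) : ℤ :=
  if i = j then 1 else if DynkinAdj N i j then -1 else 0

lemma inn_comm {N : ℕ} (x y : Fin N → ℝ) : inn x y = inn y x := by
  simp only [inn, mul_comm]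

lemma inn_kvec {N : ℕ} (x : Fin N → ℝ) (a : Fin N) : inn x (kvec a) = x a := by
  simp [inn, kvec]

lemma inn_add {N : ℕ} (x y z : Fin N → ℝ) : inn x (y + z) = inn x y + inn x z := by
  simp [inn, mul_add, Finset.sum_add_distrib]

lemma inn_sub {N : ℕ} (x y z : Fin N → ℝ) : inn x (y - z) = inn x y - inn x z := by
  simp [inn, mul_sub, Finset.sum_sub_distrib]

lemma inn_toVec {N : ℕ} (c d : Fin N → ℤ) :
    inn (toVec c) (toVec d) =
      ∑ i, ∑ j, (c i : ℝ) * d j * inn (alphaRoot i) (alphaRoot j) := by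
  simp only [inn, toVec, Finset.sum_apply, Pi.smul_apply, smul_eq_mul, Finset.sum_mul_sum]
  simp only [Finset.mul_sum]
  rw [Finset.sum_comm]
  refine Finset.sum_congr rfl fun i _ => ?_
  rw [Finset.sum_comm]
  refine Finset.sum_congr rfl fun j _ => Finset.sum_congr rfl fun a _ => ?_
  ring

lemma alphaRoot_eq_sub {N : ℕ} (i : Fin N) (hi : (i : ℕ) + 2 < N) :
    alphaRoot i = kvec i - kvec ⟨i + 1, by omega⟩ := by
  funext a
  simp only [alphaRoot, kvec, Pi.sub_apply, Fin.ext_iff]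
  split_ifs <;> first | omega | norm_num

lemma alphaRoot_eq_add {N : ℕ} (i : Fin N) (hN : 3 ≤ N) (hi : (i : ℕ) + 2 = N) :
    alphaRoot i = kvec ⟨N - 3, by omega⟩ + kvec ⟨N - 2, by omega⟩ := by
  funext a
  simp only [alphaRoot, kvec, Pi.add_apply, Fin.ext_iff]
  split_ifs <;> first | omega | norm_num

lemma inn_alphaRoot_of_lt {N : ℕ} (hN : 4 ≤ N) (i j : Fin N) (hij : j < i) :
    inn (alphaRoot i) (alphaRoot j) = if DynkinAdj N i j then -1 else 0 := by
  have hij' : (j : ℕ) < i := hij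
  have hi := i.isLt
  rcases (by omega : (j : ℕ) + 2 < N ∨ (j : ℕ) + 2 = N) with hj | hj
  · rw [alphaRoot_eq_sub j hj, inn_sub, inn_kvec, inn_kvec]
    by_cases h : DynkinAdj N i j
    all_goals
      simp only [h, if_true, if_false]
      simp only [DynkinAdj] at h
      simp only [alphaRoot]
      split_ifs <;> first | omega | norm_num
  · rw [alphaRoot_eq_add j (by omega) hj, inn_add, inn_kvec, inn_kvec]
    by_cases h : DynkinAdj N i j
    all_goals
      simp only [h, if_true, if_false]
      simp only [DynkinAdj] at h
      simp only [alphaRoot]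
      split_ifs <;> first | omega | norm_num

lemma inn_alphaRoot_self {N : ℕ} (hN : 4 ≤ N) (i : Fin N) :
    inn (alphaRoot i) (alphaRoot i) = if (i : ℕ) + 1 = N then (N : ℝ) / 4 else 2 := by
  have hi := i.isLt
  rcases (by omega : (i : ℕ) + 2 < N ∨ (i : ℕ) + 2 = N ∨ (i : ℕ) + 1 = N) with h | h | h
  · conv_lhs => rw [alphaRoot_eq_sub i h, inn_sub, inn_kvec, inn_kvec]
    simp only [kvec, Pi.sub_apply, Fin.ext_iff]
    split_ifs <;> first | omega | norm_num
  · conv_lhs => rw [alphaRoot_eq_add i (by omega) h, inn_add, inn_kvec, inn_kvec]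
    simp only [kvec, Pi.add_apply, Fin.ext_iff]
    split_ifs <;> first | omega | norm_num
  · have h' : (i : ℕ) = N - 1 := by omega
    simp only [inn, alphaRoot, h', if_true, Finset.sum_const, Finset.card_univ, Fintype.card_fin]
    rw [if_pos (by omega), nsmul_eq_mul]
    ring

lemma abs_le_one_of_mem_Phi {N : ℕ} {x : Fin N → ℝ} (hx : x ∈ Phi) (a : Fin N) : |x a| ≤ 1 := by
  rcases hx with ⟨i, j, hij, s, t, hs, ht, rfl⟩ | ⟨ε, hε, -, rfl⟩
  · have := hij.ne
    simp only [kvec, Pi.add_apply, Pi.smul_apply, smul_eq_mul]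
    rcases hs with rfl | rfl <;> rcases ht with rfl | rfl <;> split_ifs <;>
      first | (exfalso; subst_vars; contradiction) | norm_num
  · rcases hε a with h | h <;> norm_num [h, abs_le]

lemma not_mem_Phi_of_three {N : ℕ} {x : Fin N → ℝ} {a b c : Fin N} (hab : a ≠ b) (hac : a ≠ c)
    (hbc : b ≠ c) (ha : |x a| = 1) (hb : |x b| = 1) (hc : |x c| = 1) : x ∉ Phi := by
  rintro (⟨i, j, -, s, t, -, -, rfl⟩ | ⟨ε, hε, -, rfl⟩)
  · have key : ∀ d, |(s • kvec i + t • kvec j : Fin N → ℝ) d| = 1 → d = i ∨ d = j := by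
      intro d hd
      by_contra! h
      simp [kvec, h.1, h.2] at hd
    rcases key a ha with h1 | h1 <;> rcases key b hb with h2 | h2 <;>
      rcases key c hc with h3 | h3 <;> simp_all
  · rcases hε a with h | h <;> norm_num [h, abs_div] at ha

lemma alphaRoot_add_mem_PhiS {N : ℕ} (hN : 4 ≤ N) (i j : Fin N) (hi : (i : ℕ) + 1 = N)
    (hj : (j : ℕ) + 2 = N) : alphaRoot i + alphaRoot j ∈ (PhiS : Set (Fin N → ℝ)) := by
  let p : Fin N := ⟨N - 3, by omega⟩
  have hpj : p ≠ j := by simp only [p, ne_eq, Fin.ext_iff]; omega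
  refine ⟨fun a => if a = p ∨ a = j then 1 else -1, fun a => ?_, ?_, ?_⟩
  · dsimp only
    split_ifs <;> simp
  · have : (univ.filter fun a : Fin N => (if a = p ∨ a = j then (1 : ℝ) else -1) = 1) = {p, j} := by
      ext a
      simp only [Finset.mem_filter, Finset.mem_univ, true_and, Finset.mem_insert,
        Finset.mem_singleton]
      split_ifs with h
      · simpa using h
      · norm_num
        exact not_or.mp h
    rw [this, Finset.card_pair hpj]
    exact even_two
  · funext a
    simp only [alphaRoot, Pi.add_apply, Fin.ext_iff, p]
    split_ifs <;> first | omega | norm_num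

lemma alphaRoot_add_mem_Phi_iff {N : ℕ} (hN : 4 ≤ N) (i j : Fin N) (hij : j < i) :
    alphaRoot i + alphaRoot j ∈ (Phi : Set (Fin N → ℝ)) ↔ DynkinAdj N i j := by
  have hij' : (j : ℕ) < i := hij
  have hi := i.isLt
  constructor
  · contrapose
    intro h
    simp only [DynkinAdj] at h
    rcases (by omega : (i : ℕ) + 1 = N ∨ (i : ℕ) + 2 = N ∨ (i : ℕ) + 2 < N) with hi' | hi' | hi'
    · intro hmem
      have := abs_le_one_of_mem_Phi hmem ⟨j + 1, by omega⟩
      simp only [alphaRoot, Pi.add_apply] at this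
      split_ifs at this <;> first | omega | norm_num [abs_le] at this
    · rcases eq_or_ne ((j : ℕ) + 3) N with hj | hj
      · intro hmem
        have := abs_le_one_of_mem_Phi hmem j
        simp only [alphaRoot, Pi.add_apply] at this
        split_ifs at this <;> first | omega | norm_num [abs_le] at this
      · refine not_mem_Phi_of_three (a := j) (b := ⟨N - 3, by omega⟩) (c := i) ?_ ?_ ?_ ?_ ?_ ?_ <;>
          simp only [alphaRoot, Pi.add_apply, ne_eq, Fin.ext_iff, true_or, if_true] <;>
          first | omega | (split_ifs <;> first | omega | norm_num)
    · refine not_mem_Phi_of_three (a := j) (b := ⟨j + 1, by omega⟩) (c := i) ?_ ?_ ?_ ?_ ?_ ?_ <;>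
        simp only [alphaRoot, Pi.add_apply, ne_eq, Fin.ext_iff] <;>
        first | omega | (split_ifs <;> first | omega | norm_num)
  · rintro (⟨h1, h2⟩ | ⟨h1, h2⟩ | ⟨h1, h2⟩)
    · refine Or.inl ⟨j, ⟨i + 1, by omega⟩, Fin.lt_def.mpr (by dsimp only; omega), 1, -1,
        Or.inl rfl, Or.inr rfl, ?_⟩
      have hji : (⟨j + 1, by omega⟩ : Fin N) = i := Fin.ext h1
      rw [alphaRoot_eq_sub i (by omega), alphaRoot_eq_sub j (by omega), hji]
      module
    · refine Or.inl ⟨j, i, hij, 1, 1, Or.inl rfl, Or.inl rfl, ?_⟩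
      have hj : (⟨j + 1, by omega⟩ : Fin N) = ⟨N - 3, by omega⟩ := by
        rw [Fin.ext_iff]
        dsimp only
        omega
      have hi' : (⟨N - 2, by omega⟩ : Fin N) = i := by
        rw [Fin.ext_iff]
        dsimp only
        omega
      rw [alphaRoot_eq_add i (by omega) h1, alphaRoot_eq_sub j (by omega), hj, hi']
      module
    · exact Or.inr (alphaRoot_add_mem_PhiS hN i j h1 h2)

lemma DynkinAdj.lt {N i j : ℕ} (h : DynkinAdj N i j) : j < i := by
  simp only [DynkinAdj] at h
  omega

lemma epsSign_eq {N : ℕ} (hN : 4 ≤ N) (i j : Fin N) : epsSign i j = (-1) ^ epsExp i j := by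
  by_cases hij : i = j
  · simp [epsSign, epsExp, hij]
  · have h : (alphaRoot i + alphaRoot j ∈ (Phi : Set (Fin N → ℝ)) ∧ j < i) ↔ DynkinAdj N i j :=
      ⟨fun h => (alphaRoot_add_mem_Phi_iff hN i j h.2).1 h.1,
        fun h => ⟨(alphaRoot_add_mem_Phi_iff hN i j h.lt).2 h, h.lt⟩⟩
    simp only [epsSign, epsExp, if_neg hij, h]
    split_ifs <;> simp

lemma epsFun_eq {N : ℕ} (hN : 4 ≤ N) (l m : Fin N → ℤ) :
    epsFun l m = (-1) ^ ∑ i, ∑ j, epsExp i j * (l i * m j) := by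
  have hsum : ∀ (f : Fin N → ℤ), ∏ i, (-1 : ℤˣ) ^ f i = (-1) ^ ∑ i, f i := fun f => by
    induction (Finset.univ : Finset (Fin N)) using Finset.induction_on with
    | empty => simp
    | insert a s ha ih => rw [Finset.prod_insert ha, Finset.sum_insert ha, zpow_add, ih]
  simp only [epsFun, epsSign_eq hN, ← zpow_mul, hsum]

lemma inn_alphaRoot {N : ℕ} (hN : 4 ≤ N) (i j : Fin N) :
    inn (alphaRoot i) (alphaRoot j) = epsExp i j + epsExp j i +
      if i = j then (if (i : ℕ) + 1 = N then (N : ℝ) / 4 - 2 else 0) else 0 := by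
  rcases lt_trichotomy i j with h | rfl | h
  · have h' : ¬ DynkinAdj N i j := fun hd => lt_asymm h hd.lt
    rw [inn_comm, inn_alphaRoot_of_lt hN j i h]
    simp only [epsExp, if_neg h.ne, if_neg h.ne', if_neg h']
    split_ifs <;> simp
  · rw [inn_alphaRoot_self hN]
    simp only [epsExp, if_true]
    split_ifs <;> push_cast <;> ring
  · have h' : ¬ DynkinAdj N j i := fun hd => lt_asymm h hd.lt
    rw [inn_alphaRoot_of_lt hN i j h]
    simp only [epsExp, if_neg h.ne, if_neg h.ne', if_neg h']
    split_ifs <;> simp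

lemma inn_toVec_self {N : ℕ} (hN : 4 ≤ N) (m : Fin N → ℤ) :
    inn (toVec m) (toVec m) = 2 * ((∑ i, ∑ j, epsExp i j * (m i * m j) : ℤ) : ℝ) +
      (m ⟨N - 1, by omega⟩ : ℝ) ^ 2 * ((N : ℝ) / 4 - 2) := by
  have hswap : ∑ i, ∑ j, (m i : ℝ) * m j * epsExp j i = ∑ i, ∑ j, (m i : ℝ) * m j * epsExp i j := by
    rw [Finset.sum_comm]
    exact Finset.sum_congr rfl fun i _ => Finset.sum_congr rfl fun j _ => by ring
  have hlast : ∀ i : Fin N, (i : ℕ) + 1 = N ↔ i = ⟨N - 1, by omega⟩ := fun i => by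
    rw [Fin.ext_iff]
    dsimp only
    omega
  simp only [inn_toVec, inn_alphaRoot hN, mul_add, Finset.sum_add_distrib, hswap, hlast, mul_ite,
    mul_zero, Finset.sum_ite_eq, Finset.sum_ite_eq', Finset.mem_univ, if_true]
  push_cast
  simp only [mul_comm (epsExp _ _ : ℝ)]
  ring

/-- For α = ∑ m_i α_i ∈ L, the quantity e = ((α,α) - m_N²(n-1))/2 is an integer
and ε(α,α) = (-1)^e. -/
theorem stmt13 (n : ℕ) (hn : 1 ≤ n) (m : Fin (4*(n+1)) → ℤ) :
    ∃ e : ℤ,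
      inn (toVec m) (toVec m)
          - (m ⟨4*(n+1)-1, by omega⟩ : ℝ) ^ 2 * ((n : ℝ) - 1) = 2 * (e : ℝ) ∧
      epsFun m m = (-1 : ℤˣ) ^ e := by
  refine ⟨_, ?_, epsFun_eq (by omega) m m⟩
  rw [inn_toVec_self (by omega)]
  push_cast
  ring
end
end
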